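/- arXiv:2403.16498 — 5 statements merged into one kernel-verified Lean document; each statement's English description precedes it below -/
import Mathlib

section
/- Under the assumption γ2 < γ1 (i.e., |h2|² < |h1|² as used in the paper's proof), the pure OMA point (P0, P1, P2) = (0, ε/γ1, ε/γ2) is not an optimal solution of problem (P3): there exists a feasible triple (P0, P1, P2) for (P3) whose objective value P1 + P2 is strictly smaller than ε/γ1 + ε/γ2. -/
/-- Under γ2 < γ1, the pure OMA point (0, ε/γ1, ε/γ2) is not optimal for
problem (P3): some feasible triple has strictly smaller objective P1 + P2. -/
theorem oma_not_optimal_for_P3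
    (γ0 γ1 γ2 R ε : ℝ)
    (hγ0 : 0 < γ0) (hγ1 : 0 < γ1) (hγ2 : 0 < γ2) (hR : 0 < R)
    (hε : ε = Real.exp R - 1)
    (h21 : γ2 < γ1) :
    ∃ P0 P1 P2 : ℝ,
      (0 ≤ P0 ∧ 0 ≤ P1 ∧ 0 ≤ P2 ∧
        R ≤ Real.log (1 + γ0 * P0) + Real.log (1 + γ2 * P2) ∧
        ε * γ0 * P0 + ε ≤ γ1 * P1 ∧
        P0 ≤ P1) ∧
      P1 + P2 < ε / γ1 + ε / γ2 := by
  have hε0 : 0 < ε := by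
    have := Real.add_one_lt_exp hR.ne'
    linarith
  -- `x` is the received backscatter power `γ0 * P0`, with (C1) and (C2) tight.
  obtain ⟨x, hx0, hxε, hεx, hxγ⟩ : ∃ x : ℝ, 0 < x ∧ x ≤ ε ∧ ε * x ≤ 1 ∧ x * γ1 ≤ ε * γ0 := by
    refine ⟨min ε (min (1 / ε) (ε * γ0 / γ1)), by positivity, min_le_left _ _, ?_, ?_⟩
    · rw [mul_comm, ← le_div_iff₀ hε0]
      exact (min_le_right _ _).trans (min_le_left _ _)
    · rw [← le_div_iff₀ hγ1]
      exact (min_le_right _ _).trans (min_le_right _ _)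
  have hx1 : 0 < 1 + x := by linarith
  refine ⟨x / γ0, ε * (1 + x) / γ1, (ε - x) / (1 + x) / γ2,
    ⟨by positivity, by positivity, ?_, ?_, ?_, ?_⟩, ?_⟩
  · exact div_nonneg (div_nonneg (sub_nonneg.2 hxε) hx1.le) hγ2.le
  · have hP2 : 1 + (ε - x) / (1 + x) = Real.exp R / (1 + x) := by
      rw [hε]
      field_simp
      ring
    rw [mul_div_cancel₀ _ hγ0.ne', mul_div_cancel₀ _ hγ2.ne', hP2,
      Real.log_div (Real.exp_pos R).ne' hx1.ne', Real.log_exp]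
    linarith
  · rw [mul_assoc, mul_div_cancel₀ _ hγ0.ne', mul_div_cancel₀ _ hγ1.ne']
    linarith
  · rw [div_le_div_iff₀ hγ0 hγ1]
    nlinarith [mul_pos (mul_pos hε0 hx0) hγ0]
  · have hgain : ε / γ1 + ε / γ2 - (ε * (1 + x) / γ1 + (ε - x) / (1 + x) / γ2)
        = x * ((1 + ε) * γ1 - ε * (1 + x) * γ2) / ((1 + x) * γ1 * γ2) := by
      field_simp
      ring
    have hpos : 0 < (1 + ε) * γ1 - ε * (1 + x) * γ2 := by
      nlinarith [mul_nonneg (sub_nonneg.2 hεx) hγ2.le]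
    rw [← sub_pos, hgain]
    positivity
end

section
/- The pure NOMA point (P0, P1, P2) = (ε/γ2, ε(1+ε)/γ1, 0) is not an optimal solution of the conventional H-NOMA power-minimization problem: there exists a feasible triple (P0, P1, P2) for the conventional problem whose objective value P0 + P1 + P2 is strictly smaller than ε/γ2 + ε(1+ε)/γ1. -/
/-- The pure NOMA point (ε/γ2, ε(1+ε)/γ1, 0) is not optimal for the two-user
conventional H-NOMA power-minimization problem: some feasible triple has
strictly smaller objective P0 + P1 + P2. -/
theorem pure_noma_not_optimal_conventional
    (γ1 γ2 R ε : ℝ)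
    (hγ1 : 0 < γ1) (hγ2 : 0 < γ2) (hR : 0 < R)
    (hε : ε = Real.exp R - 1) :
    ∃ P0 P1 P2 : ℝ,
      (0 ≤ P0 ∧ 0 ≤ P1 ∧ 0 ≤ P2 ∧
        R ≤ Real.log (1 + γ2 * P0) + Real.log (1 + γ2 * P2) ∧
        ε * (1 + γ2 * P0) ≤ γ1 * P1) ∧
      P0 + P1 + P2 < ε / γ2 + ε * (1 + ε) / γ1 := by
  have hε_pos : 0 < ε := by linarith [Real.add_one_le_exp R]
  have h_exp : 1 + ε = Real.exp R := by linarith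
  -- The pure OMA point is feasible and strictly better.
  refine ⟨0, ε / γ1, ε / γ2, ⟨le_rfl, by positivity, by positivity, ?_, ?_⟩, ?_⟩
  · rw [mul_div_cancel₀ _ hγ2.ne', h_exp, Real.log_exp]
    simp
  · rw [mul_div_cancel₀ _ hγ1.ne']
    simp
  · have h_lt : ε / γ1 < ε * (1 + ε) / γ1 := by
      gcongr
      nlinarith
    linarith
end

section
/- Suppose (1+ε)·γ2 ≤ γ0 and γ1 ≥ (1+ε)·γ0. Then the pure NOMA point (P0, P1, P2) = (ε/γ0, ε/γ0, 0) is an optimal solution of problem (P3): it is feasible for (P3), and every feasible triple (P0, P1, P2) for (P3) satisfies P1 + P2 ≥ ε/γ0. In particular the optimal value of (P3) equals ε/γ0. -/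
/-- If (1+ε)·γ2 ≤ γ0 and γ1 ≥ (1+ε)·γ0, then the pure NOMA point
(ε/γ0, ε/γ0, 0) is optimal for problem (P3): it is feasible and every
feasible triple satisfies P1 + P2 ≥ ε/γ0. -/
theorem pure_noma_typeI_optimal_P3
    (γ0 γ1 γ2 R ε : ℝ)
    (hγ0 : 0 < γ0) (hγ1 : 0 < γ1) (hγ2 : 0 < γ2) (hR : 0 < R)
    (hε : ε = Real.exp R - 1)
    (hc1 : (1 + ε) * γ2 ≤ γ0) (hc2 : (1 + ε) * γ0 ≤ γ1) :
    ((0 : ℝ) ≤ ε / γ0 ∧ (0 : ℝ) ≤ ε / γ0 ∧ (0 : ℝ) ≤ (0 : ℝ) ∧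
      R ≤ Real.log (1 + γ0 * (ε / γ0)) + Real.log (1 + γ2 * 0) ∧
      ε * γ0 * (ε / γ0) + ε ≤ γ1 * (ε / γ0) ∧
      ε / γ0 ≤ ε / γ0) ∧
    (∀ P0 P1 P2 : ℝ,
      0 ≤ P0 → 0 ≤ P1 → 0 ≤ P2 →
      R ≤ Real.log (1 + γ0 * P0) + Real.log (1 + γ2 * P2) →
      ε * γ0 * P0 + ε ≤ γ1 * P1 →
      P0 ≤ P1 →
      ε / γ0 ≤ P1 + P2) := by
  have hε0 : 0 < ε := by
    have := Real.add_one_lt_exp hR.ne'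
    linarith
  have hexp : Real.exp R = 1 + ε := by linarith
  have hcancel : γ0 * (ε / γ0) = ε := mul_div_cancel₀ ε hγ0.ne'
  have hpos : 0 ≤ ε / γ0 := by positivity
  refine ⟨⟨hpos, hpos, le_rfl, ?_, ?_, le_rfl⟩, ?_⟩
  · rw [hcancel, ← hexp, Real.log_exp]
    simp
  · calc ε * γ0 * (ε / γ0) + ε = (1 + ε) * γ0 * (ε / γ0) := by
          rw [mul_assoc, mul_assoc, hcancel]
          ring
      _ ≤ γ1 * (ε / γ0) := mul_le_mul_of_nonneg_right hc2 hpos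
  · intro P0 P1 P2 h0 _ h2 hrate _ h01
    have ha : 0 < 1 + γ0 * P0 := by positivity
    have hb : 0 < 1 + γ2 * P2 := by positivity
    have hprod : 1 + ε ≤ (1 + γ0 * P0) * (1 + γ2 * P2) := by
      rw [← Real.log_mul ha.ne' hb.ne', Real.le_log_iff_exp_le (mul_pos ha hb), hexp] at hrate
      exact hrate
    suffices ε / γ0 ≤ P0 + P2 by linarith
    rw [div_le_iff₀ hγ0]
    rcases le_total ε (γ0 * P0) with h | h
    · nlinarith [mul_nonneg hγ0.le h2]
    · have hswap : (1 + γ0 * P0) * (γ2 * P2) ≤ (1 + ε) * (γ2 * P2) :=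
        mul_le_mul_of_nonneg_right (by linarith) (by positivity)
      have hgain : (1 + ε) * γ2 * P2 ≤ γ0 * P2 := mul_le_mul_of_nonneg_right hc1 h2
      linarith
end

section
/- Suppose ε·(1+ε)·γ2 ≤ γ1 and γ1 ≤ (1+ε)·γ0. Then the pure NOMA point (P0, P1, P2) = (ε/γ0, ε(1+ε)/γ1, 0) is an optimal solution of problem (P3): it is feasible for (P3), and every feasible triple (P0, P1, P2) for (P3) satisfies P1 + P2 ≥ ε(1+ε)/γ1. In particular the optimal value of (P3) equals ε(1+ε)/γ1. -/
/-- If `E ≤ x * y` with `E ≥ 0` and `y > 0`, then `E ≤ x + E * (y - 1)`, since `y + 1 / y ≥ 2`. -/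
lemma le_add_mul_sub_one_of_le_mul {E x y : ℝ} (hE : 0 ≤ E) (hy : 0 < y) (h : E ≤ x * y) :
    E ≤ x + E * (y - 1) := by
  refine le_of_mul_le_mul_right ?_ hy
  nlinarith [mul_nonneg hE (sq_nonneg (y - 1))]

/-- If ε(1+ε)·γ2 ≤ γ1 and γ1 ≤ (1+ε)·γ0, then the pure NOMA point
(ε/γ0, ε(1+ε)/γ1, 0) is optimal for problem (P3): it is feasible and every
feasible triple satisfies P1 + P2 ≥ ε(1+ε)/γ1. -/
theorem pure_noma_typeII_optimal_P3
    (γ0 γ1 γ2 R ε : ℝ)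
    (hγ0 : 0 < γ0) (hγ1 : 0 < γ1) (hγ2 : 0 < γ2) (hR : 0 < R)
    (hε : ε = Real.exp R - 1)
    (hc1 : ε * (1 + ε) * γ2 ≤ γ1) (hc2 : γ1 ≤ (1 + ε) * γ0) :
    ((0 : ℝ) ≤ ε / γ0 ∧ (0 : ℝ) ≤ ε * (1 + ε) / γ1 ∧ (0 : ℝ) ≤ (0 : ℝ) ∧
      R ≤ Real.log (1 + γ0 * (ε / γ0)) + Real.log (1 + γ2 * 0) ∧
      ε * γ0 * (ε / γ0) + ε ≤ γ1 * (ε * (1 + ε) / γ1) ∧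
      ε / γ0 ≤ ε * (1 + ε) / γ1) ∧
    (∀ P0 P1 P2 : ℝ,
      0 ≤ P0 → 0 ≤ P1 → 0 ≤ P2 →
      R ≤ Real.log (1 + γ0 * P0) + Real.log (1 + γ2 * P2) →
      ε * γ0 * P0 + ε ≤ γ1 * P1 →
      P0 ≤ P1 →
      ε * (1 + ε) / γ1 ≤ P1 + P2) := by
  have hexp : Real.exp R = 1 + ε := by linarith
  have hεpos : 0 < ε := by linarith [Real.add_one_lt_exp hR.ne']
  have hcancel : γ0 * (ε / γ0) = ε := mul_div_cancel₀ ε hγ0.ne'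
  refine ⟨⟨by positivity, by positivity, le_rfl, ?_, ?_, ?_⟩, ?_⟩
  · rw [hcancel, ← hexp]
    simp
  · rw [mul_assoc, hcancel, mul_div_cancel₀ _ hγ1.ne']
    exact le_of_eq (by ring)
  · rw [div_le_div_iff₀ hγ0 hγ1]
    nlinarith [mul_le_mul_of_nonneg_left hc2 hεpos.le]
  · intro P0 P1 P2 hP0 _ hP2 hrate hsic _
    have hx : 0 < 1 + γ0 * P0 := by positivity
    have hy : 0 < 1 + γ2 * P2 := by positivity
    rw [← Real.log_mul hx.ne' hy.ne', Real.le_log_iff_exp_le (mul_pos hx hy), hexp] at hrate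
    have key := mul_le_mul_of_nonneg_left
      (le_add_mul_sub_one_of_le_mul (by positivity) hy hrate) hεpos.le
    rw [div_le_iff₀ hγ1]
    nlinarith [mul_le_mul_of_nonneg_right hc1 hP2]
end

section
/- Consider the pure NOMA subproblem of BackCom assisted H-NOMA: minimize P1 over real variables P0, P1 ≥ 0 subject to log(1 + γ0·P0) ≥ R, ε·γ0·P0 + ε ≤ γ1·P1, and P0 ≤ P1. The optimal value of this problem equals max{ε/γ0, ε(1+ε)/γ1}, and it is attained at P0 = ε/γ0 and P1 = max{ε/γ0, ε(1+ε)/γ1}; that is, this pair is feasible, and every feasible pair (P0, P1) satisfies P1 ≥ max{ε/γ0, ε(1+ε)/γ1}. -/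
/-- Pure NOMA subproblem of BackCom assisted H-NOMA: minimize P1 over
P0, P1 ≥ 0 subject to log(1+γ0·P0) ≥ R, ε·γ0·P0 + ε ≤ γ1·P1 and P0 ≤ P1.
The optimal value is max{ε/γ0, ε(1+ε)/γ1}, attained at
P0 = ε/γ0, P1 = max{ε/γ0, ε(1+ε)/γ1}. -/
theorem pure_noma_subproblem_backcom
    (γ0 γ1 R ε : ℝ)
    (hγ0 : 0 < γ0) (hγ1 : 0 < γ1) (hR : 0 < R)
    (hε : ε = Real.exp R - 1) :
    ((0 : ℝ) ≤ ε / γ0 ∧ (0 : ℝ) ≤ max (ε / γ0) (ε * (1 + ε) / γ1) ∧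
      R ≤ Real.log (1 + γ0 * (ε / γ0)) ∧
      ε * γ0 * (ε / γ0) + ε ≤ γ1 * max (ε / γ0) (ε * (1 + ε) / γ1) ∧
      ε / γ0 ≤ max (ε / γ0) (ε * (1 + ε) / γ1)) ∧
    (∀ P0 P1 : ℝ,
      0 ≤ P0 → 0 ≤ P1 →
      R ≤ Real.log (1 + γ0 * P0) →
      ε * γ0 * P0 + ε ≤ γ1 * P1 →
      P0 ≤ P1 →
      max (ε / γ0) (ε * (1 + ε) / γ1) ≤ P1) := by
  have hε_pos : 0 < ε := by
    have := Real.add_one_lt_exp hR.ne'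
    linarith
  have hcancel : γ0 * (ε / γ0) = ε := mul_div_cancel₀ ε hγ0.ne'
  have hP0 : 0 ≤ ε / γ0 := by positivity
  refine ⟨⟨hP0, le_max_of_le_left hP0, ?_, ?_, le_max_left _ _⟩, ?_⟩
  · rw [hcancel, hε, add_sub_cancel, Real.log_exp]
  · calc ε * γ0 * (ε / γ0) + ε = γ1 * (ε * (1 + ε) / γ1) := by
          field_simp
          ring
      _ ≤ γ1 * max (ε / γ0) (ε * (1 + ε) / γ1) := by
          gcongr
          exact le_max_right _ _
  · intro P0 P1 hP0_nonneg _ hrate hsinr hle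
    have hε_le : ε ≤ γ0 * P0 := by
      have := (Real.le_log_iff_exp_le (by positivity)).mp hrate
      linarith
    refine max_le ?_ ?_
    · rw [div_le_iff₀' hγ0]
      exact hε_le.trans (by gcongr)
    · rw [div_le_iff₀' hγ1]
      have := mul_le_mul_of_nonneg_left hε_le hε_pos.le
      linarith
end
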